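/- For all integers s ≥ 0 and k ≥ 1, the monic orthogonal polynomials with respect to μ satisfy Q_{2^s(2k+1)} = Q_{2^s}·Q_{2^{s+1}k} − (||Q_{2^{s+1}k}||² / ||Q_{2^s(2k−1)}||²)·Q_{2^s(2k−1)}. -/

import Mathlib

open Polynomial MeasureTheory Filter

/-- `r γ s` : the recursively defined scales `r 0 = 1`, `r (s+1) = γ (s+1) * (r s)²`. -/
noncomputable def r (γ : ℕ → ℝ) : ℕ → ℝ
  | 0 => 1
  | s + 1 => γ (s + 1) * (r γ s) ^ 2

/-- `P γ s` : the polynomial `P_{2^s}`, with `P_1 = X - 1` and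
`P_{2^{s+1}} = P_{2^s} · (P_{2^s} + r_s)`. -/
noncomputable def P (γ : ℕ → ℝ) : ℕ → Polynomial ℝ
  | 0 => X - 1
  | s + 1 => P γ s * (P γ s + C (r γ s))

/-- The integral `∫ f dν_s` of a function `f` against the normalized counting measure `ν_s`
on the `2^s` (simple, real) zeros of `P_{2^s} + r_s/2`. -/
noncomputable def nuInt (γ : ℕ → ℝ) (s : ℕ) (f : ℝ → ℝ) : ℝ :=
  (((P γ s + C (r γ s / 2)).roots.map f).sum) / 2 ^ s

/-- `R γ s = P_{2^s} + r_s/2`. -/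
noncomputable def RR (γ : ℕ → ℝ) (s : ℕ) : Polynomial ℝ := P γ s + C (r γ s / 2)

/-- sum of `p` over the roots of `R_s - y`. -/
noncomputable def SS (γ : ℕ → ℝ) (s : ℕ) (y : ℝ) (p : Polynomial ℝ) : ℝ :=
  ((RR γ s - C y).roots.map (fun x => p.eval x)).sum

lemma RR_zero (γ : ℕ → ℝ) : RR γ 0 = X - C (1/2) := by
  have h : (C (1/2) + C (1/2) : ℝ[X]) = 1 := by rw [← C_add]; norm_num
  simp only [RR, P, r]
  linear_combination h

lemma RR_succ (γ : ℕ → ℝ) (s : ℕ) :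
    RR γ (s+1) = RR γ s ^ 2 - C (r γ s ^ 2 / 4 - r γ (s+1) / 2) := by
  have h1 : (C (r γ s) : ℝ[X]) = C (r γ s / 2) + C (r γ s / 2) := by rw [← C_add]; norm_num
  have h2 : (C (r γ s ^ 2 / 4 - r γ (s+1) / 2) : ℝ[X])
      = C (r γ s / 2) ^ 2 - C (r γ (s+1) / 2) := by
    rw [← C_pow, ← C_sub]; congr 1; ring
  rw [h2]
  simp only [RR, P]
  rw [h1]; ring

lemma RR_monic (γ : ℕ → ℝ) (s : ℕ) : (RR γ s).Monic ∧ (RR γ s).natDegree = 2 ^ s := by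
  induction s with
  | zero => rw [RR_zero]; exact ⟨monic_X_sub_C _, by simp⟩
  | succ s ih =>
    have hm : (RR γ s ^ 2).Monic := ih.1.pow 2
    have hd : (RR γ s ^ 2).natDegree = 2 ^ (s+1) := by
      rw [ih.1.natDegree_pow, ih.2]; ring
    rw [RR_succ]
    refine ⟨hm.sub_of_left ?_, by rw [natDegree_sub_C, hd]⟩
    refine lt_of_le_of_lt degree_C_le ?_
    rw [← natDegree_pos_iff_degree_pos, hd]; positivity

lemma RR_sub_ne (γ : ℕ → ℝ) (s : ℕ) (y : ℝ) : RR γ s - C y ≠ 0 := by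
  intro h
  have h2 := (RR_monic γ s).2
  have : (RR γ s - C y).natDegree = 2 ^ s := by rw [natDegree_sub_C, h2]
  rw [h] at this
  simp at this
  have h3 : 0 < 2 ^ s := by positivity
  omega

lemma r_pos (γ : ℕ → ℝ) (hγ : ∀ s : ℕ, 0 < γ (s + 1) ∧ γ (s + 1) < 1 / 4) (s : ℕ) :
    0 < r γ s := by
  induction s with
  | zero => simp [r]
  | succ s ih => have := (hγ s).1; simp only [r]; positivity

lemma SS_succ (γ : ℕ → ℝ) (hγ : ∀ s : ℕ, 0 < γ (s + 1) ∧ γ (s + 1) < 1 / 4) (s : ℕ) (y : ℝ)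
    (hy : |y| ≤ r γ (s+1) / 2) :
    ∃ w : ℝ, |w| ≤ r γ s / 2 ∧ ∀ p, SS γ (s+1) y p = SS γ s w p + SS γ s (-w) p := by
  have hr := r_pos γ hγ s
  have hg := hγ s
  have hr1 : r γ (s+1) = γ (s+1) * r γ s ^ 2 := by simp only [r]
  obtain ⟨hy1, hy2⟩ := abs_le.1 hy
  have hnn : 0 ≤ r γ s ^ 2 / 4 - r γ (s+1) / 2 + y := by
    have : 0 < r γ s ^ 2 := by positivity
    nlinarith
  refine ⟨Real.sqrt (r γ s ^ 2 / 4 - r γ (s+1) / 2 + y), ?_, ?_⟩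
  · rw [abs_of_nonneg (Real.sqrt_nonneg _)]
    apply Real.sqrt_le_iff.2
    refine ⟨by positivity, ?_⟩
    nlinarith
  · intro p
    set w := Real.sqrt (r γ s ^ 2 / 4 - r γ (s+1) / 2 + y) with hw
    have hw2 : w ^ 2 = r γ s ^ 2 / 4 - r γ (s+1) / 2 + y := Real.sq_sqrt hnn
    have hf : RR γ (s+1) - C y = (RR γ s - C w) * (RR γ s - C (-w)) := by
      have : (C (r γ s ^ 2 / 4 - r γ (s+1) / 2) : ℝ[X]) = C w ^ 2 - C y := by
        rw [← C_pow, ← C_sub, hw2]; congr 1; ring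
      rw [RR_succ, this, C_neg]; ring
    unfold SS
    rw [hf, roots_mul (mul_ne_zero (RR_sub_ne _ _ _) (RR_sub_ne _ _ _)), Multiset.map_add,
      Multiset.sum_add]

lemma SS_add (γ : ℕ → ℝ) (s : ℕ) (y : ℝ) (p q : ℝ[X]) :
    SS γ s y (p + q) = SS γ s y p + SS γ s y q := by
  simp [SS, Multiset.sum_map_add]

lemma SS_one (γ : ℕ → ℝ) (hγ : ∀ s : ℕ, 0 < γ (s + 1) ∧ γ (s + 1) < 1 / 4) (s : ℕ) :
    ∀ y : ℝ, |y| ≤ r γ s / 2 → SS γ s y 1 = 2 ^ s := by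
  induction s with
  | zero =>
    intro y _
    have : RR γ 0 - C y = X - C (1/2 + y) := by rw [RR_zero, C_add]; ring
    simp [SS, this, -map_add]
  | succ s ih =>
    intro y hy
    obtain ⟨w, hw, h⟩ := SS_succ γ hγ s y hy
    rw [h, ih w hw, ih (-w) (by rwa [abs_neg])]; ring

lemma SS_mul (γ : ℕ → ℝ) (s : ℕ) (y : ℝ) (p f : ℝ[X]) :
    SS γ s y (p * f.comp (RR γ s)) = f.eval y * SS γ s y p := by
  unfold SS
  rw [← Multiset.sum_map_mul_left]
  congr 1
  apply Multiset.map_congr rfl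
  intro x hx
  have : (RR γ s - C y).eval x = 0 := isRoot_of_mem_roots hx
  have h2 : (RR γ s).eval x = y := by simpa [sub_eq_zero] using this
  simp [eval_comp, h2, mul_comm]

lemma SS_const (γ : ℕ → ℝ) (hγ : ∀ s : ℕ, 0 < γ (s + 1) ∧ γ (s + 1) < 1 / 4) (s : ℕ) :
    ∀ p : ℝ[X], p.degree < ((2 ^ s : ℕ) : WithBot ℕ) →
      ∃ c : ℝ, ∀ y : ℝ, |y| ≤ r γ s / 2 → SS γ s y p = c := by
  induction s with
  | zero =>
    intro p hp
    have : p = C (p.coeff 0) := by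
      apply eq_C_of_degree_le_zero
      apply Nat.WithBot.lt_one_iff_le_zero.1
      simpa using hp
    refine ⟨p.coeff 0, fun y hy => ?_⟩
    have h := SS_mul γ 0 y 1 (C (p.coeff 0))
    rw [SS_one γ hγ 0 y hy] at h
    simp only [C_comp, one_mul, eval_C, pow_zero, mul_one] at h
    rwa [← this] at h
  | succ s ih =>
    intro p hp
    obtain ⟨hm, hd⟩ := RR_monic γ s
    have hdiv := modByMonic_add_div p (RR γ s)
    have hb : (p %ₘ RR γ s).degree < ((2 ^ s : ℕ) : WithBot ℕ) := by
      have := degree_modByMonic_lt p hm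
      rwa [degree_eq_natDegree hm.ne_zero, hd] at this
    have ha : (p /ₘ RR γ s).degree < ((2 ^ s : ℕ) : WithBot ℕ) := by
      by_cases h0 : p /ₘ RR γ s = 0
      · rw [h0, degree_zero]; exact WithBot.bot_lt_coe _
      · have hp0 : p ≠ 0 := by rintro rfl; simp at h0
        rw [← natDegree_lt_iff_degree_lt h0, natDegree_divByMonic _ hm, hd]
        rw [← natDegree_lt_iff_degree_lt hp0, pow_succ] at hp
        have : 0 < 2 ^ s := by positivity
        omega
    obtain ⟨ca, hca⟩ := ih _ ha
    obtain ⟨cb, hcb⟩ := ih _ hb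
    refine ⟨2 * cb, fun y hy => ?_⟩
    obtain ⟨w, hw, h⟩ := SS_succ γ hγ s y hy
    have hw' : |-w| ≤ r γ s / 2 := by rwa [abs_neg]
    have key : ∀ v : ℝ, |v| ≤ r γ s / 2 → SS γ s v p = cb + v * ca := by
      intro v hv
      have h1 := SS_mul γ s v (p /ₘ RR γ s) X
      rw [X_comp, eval_X, hca v hv] at h1
      rw [← hcb v hv, ← h1, ← SS_add]
      congr 1
      rw [mul_comm (p /ₘ RR γ s), hdiv]
    rw [h, key w hw, key _ hw']; ring

lemma SS_odd (γ : ℕ → ℝ) (hγ : ∀ s : ℕ, 0 < γ (s + 1) ∧ γ (s + 1) < 1 / 4) (s : ℕ)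
    (f : ℝ[X]) (hf : f.comp (-X) = -f) (t : ℕ) (hst : s + 1 ≤ t) :
    ∀ y : ℝ, |y| ≤ r γ t / 2 → SS γ t y (f.comp (RR γ s)) = 0 := by
  induction t, hst using Nat.le_induction with
  | base =>
    intro y hy
    obtain ⟨w, hw, h⟩ := SS_succ γ hγ s y hy
    have hw' : |-w| ≤ r γ s / 2 := by rwa [abs_neg]
    have he : f.eval (-w) = - f.eval w := by
      have := congrArg (eval w) hf
      simpa [eval_comp] using this
    rw [h, ← one_mul (f.comp _), SS_mul, SS_mul, SS_one γ hγ s w hw, SS_one γ hγ s _ hw', he]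
    ring
  | succ t ht ih =>
    intro y hy
    obtain ⟨w, hw, h⟩ := SS_succ γ hγ t y hy
    have hw' : |-w| ≤ r γ t / 2 := by rwa [abs_neg]
    rw [h, ih w hw, ih _ hw']; ring

lemma SS_prod (γ : ℕ → ℝ) (hγ : ∀ s : ℕ, 0 < γ (s + 1) ∧ γ (s + 1) < 1 / 4) (s : ℕ)
    (p : ℝ[X]) (hp : p.degree < ((2 ^ s : ℕ) : WithBot ℕ)) :
    ∃ c : ℝ, ∀ f : ℝ[X], ∀ t, s ≤ t → ∀ y : ℝ, |y| ≤ r γ t / 2 →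
      SS γ t y (p * f.comp (RR γ s)) = c * SS γ t y (f.comp (RR γ s)) := by
  obtain ⟨c, hc⟩ := SS_const γ hγ s p hp
  refine ⟨c / 2 ^ s, fun f t hst => ?_⟩
  induction t, hst using Nat.le_induction with
  | base =>
    intro y hy
    have h1 := SS_mul γ s y 1 f
    rw [one_mul] at h1
    rw [SS_mul, hc y hy, h1, SS_one γ hγ s y hy]
    field_simp
  | succ t ht ih =>
    intro y hy
    obtain ⟨w, hw, h⟩ := SS_succ γ hγ t y hy
    have hw' : |-w| ≤ r γ t / 2 := by rwa [abs_neg]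
    rw [h, h, ih w hw, ih _ hw']; ring

lemma orth_aux (L : ℝ[X] →ₗ[ℝ] ℝ) (N : ℕ) (R : ℝ[X]) (hR : R.Monic) (hN : R.natDegree = N)
    (hA : ∀ p f : ℝ[X], p.degree < (N : WithBot ℕ) → L (p * f.comp R) = L p * L (f.comp R))
    (m : ℕ) : ∀ g : ℝ[X], (∀ j, j < m → L (g.comp R * R ^ j) = 0) →
      ∀ p : ℝ[X], p.degree < ((N * m : ℕ) : WithBot ℕ) → L (g.comp R * p) = 0 := by
  induction m with
  | zero =>
    intro g _ p hp
    have : p = 0 := by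
      by_contra h0
      rw [← natDegree_lt_iff_degree_lt h0] at hp
      omega
    simp [this]
  | succ m ih =>
    intro g hg p hp
    have hb : (p %ₘ R).degree < (N : WithBot ℕ) := by
      have := degree_modByMonic_lt p hR
      rwa [degree_eq_natDegree hR.ne_zero, hN] at this
    have hdiv := modByMonic_add_div p R
    have h1 : L ((g * X).comp R * (p /ₘ R)) = 0 := by
      by_cases h0 : p /ₘ R = 0
      · simp [h0]
      apply ih
      · intro j hj
        have := hg (j+1) (by omega)
        rw [mul_comp, X_comp, mul_assoc, ← pow_succ']; exact this
      · have hp0 : p ≠ 0 := by rintro rfl; simp at h0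
        have hle : R.natDegree ≤ p.natDegree := by
          by_contra hlt
          exact h0 ((divByMonic_eq_zero_iff hR).2 (degree_lt_degree (by omega)))
        rw [← natDegree_lt_iff_degree_lt h0, natDegree_divByMonic _ hR, hN]
        rw [← natDegree_lt_iff_degree_lt hp0, mul_add] at hp
        omega
    have h2 : L (g.comp R * (p %ₘ R)) = 0 := by
      rw [mul_comm, hA _ _ hb]
      have := hg 0 (by omega)
      rw [pow_zero, mul_one] at this
      rw [this, mul_zero]
    have : g.comp R * p = g.comp R * (p %ₘ R) + (g * X).comp R * (p /ₘ R) := by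
      rw [mul_comp, X_comp]
      linear_combination -(g.comp R) * hdiv
    rw [this, map_add, h1, h2, add_zero]

lemma Q_unique (L : ℝ[X] →ₗ[ℝ] ℝ) (hpos : ∀ p, p ≠ 0 → 0 < L (p ^ 2)) (n : ℕ) (A B : ℝ[X])
    (hA : A.Monic) (hB : B.Monic) (hAd : A.natDegree = n) (hBd : B.natDegree = n)
    (hAo : ∀ p : ℝ[X], p.degree < (n : WithBot ℕ) → L (A * p) = 0)
    (hBo : ∀ p : ℝ[X], p.degree < (n : WithBot ℕ) → L (B * p) = 0) : A = B := by
  by_contra hne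
  have hd : (A - B).degree < (n : WithBot ℕ) := by
    have := degree_sub_lt_left (p := A) (q := B)
      (by rw [degree_eq_natDegree hA.ne_zero, degree_eq_natDegree hB.ne_zero, hAd, hBd])
      hA.ne_zero (by rw [hA.leadingCoeff, hB.leadingCoeff])
    rwa [degree_eq_natDegree hA.ne_zero, hAd] at this
  have h := hpos (A - B) (sub_ne_zero.2 hne)
  rw [sq, sub_mul, map_sub, hAo _ hd, hBo _ hd] at h
  simp at h

lemma rec_aux (L : ℝ[X] →ₗ[ℝ] ℝ) (hpos : ∀ p, p ≠ 0 → 0 < L (p ^ 2))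
    (N : ℕ) (hN0 : 0 < N) (R : ℝ[X]) (hR : R.Monic) (hN : R.natDegree = N)
    (hA : ∀ p f : ℝ[X], p.degree < (N : WithBot ℕ) → L (p * f.comp R) = L p * L (f.comp R))
    (hB : ∀ f : ℝ[X], f.comp (-X) = -f → L (f.comp R) = 0)
    (Q : ℕ → ℝ[X]) (hQm : ∀ n, (Q n).Monic) (hQd : ∀ n, (Q n).natDegree = n)
    (hQo : ∀ n : ℕ, ∀ p : ℝ[X], p.degree < (n : WithBot ℕ) → L (Q n * p) = 0) :
    Q N = R ∧ ∀ m, Q (N * (m+2)) = R * Q (N * (m+1)) -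
      C (L (Q (N * (m+1)) ^ 2) / L (Q (N * m) ^ 2)) * Q (N * m) := by
  have hQN : Q N = R := by
    refine Q_unique L hpos N _ _ (hQm N) hR (hQd N) hN (hQo N) ?_
    intro p hp
    have h1 := hA p X hp
    have h2 := hB X (by simp)
    rw [h2, X_comp, mul_zero, mul_comm] at h1
    exact h1
  refine ⟨hQN, ?_⟩
  -- `L (Q_{Nm} R^m) = L (Q_{Nm}^2)`
  have hlead : ∀ m, L (Q (N * m) * R ^ m) = L (Q (N * m) ^ 2) := by
    intro m
    by_cases hne : R ^ m = Q (N * m)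
    · rw [hne, sq]
    have hd : (R ^ m - Q (N * m)).degree < ((N * m : ℕ) : WithBot ℕ) := by
      have hmm : (R ^ m).Monic := hR.pow m
      have hdd : (R ^ m).natDegree = N * m := by rw [hR.natDegree_pow, hN, mul_comm]
      have := degree_sub_lt_left (p := R ^ m) (q := Q (N * m))
        (by rw [degree_eq_natDegree hmm.ne_zero, degree_eq_natDegree (hQm _).ne_zero, hdd, hQd])
        hmm.ne_zero (by rw [hmm.leadingCoeff, (hQm _).leadingCoeff])
      rwa [degree_eq_natDegree hmm.ne_zero, hdd] at this
    have h := hQo _ _ hd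
    rw [mul_sub, map_sub, sub_eq_zero] at h
    rw [h, sq]
  have hlow : ∀ m j, j < m → L (Q (N * m) * R ^ j) = 0 := by
    intro m j hj
    apply hQo
    rw [degree_eq_natDegree (hR.pow j).ne_zero, hR.natDegree_pow, hN, Nat.cast_lt, mul_comm]
    exact Nat.mul_lt_mul_of_pos_left hj hN0
  have step : ∀ m, ∀ q0 q1 : ℝ[X], Q (N * m) = q0.comp R → Q (N * (m+1)) = q1.comp R →
      q0.comp (-X) = (-1) ^ m * q0 → q1.comp (-X) = (-1) ^ (m+1) * q1 →
      Q (N * (m+2)) = R * Q (N * (m+1)) -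
        C (L (Q (N * (m+1)) ^ 2) / L (Q (N * m) ^ 2)) * Q (N * m) := by
    intro m q0 q1 h0 h1 e0 e1
    set a := L (Q (N * (m+1)) ^ 2) / L (Q (N * m) ^ 2) with ha
    have hgR : (X * q1 - C a * q0).comp R = R * Q (N * (m+1)) - C a * Q (N * m) := by
      rw [h0, h1]; simp
    have hge : (X * q1 - C a * q0).comp (-X) = (-1) ^ m * (X * q1 - C a * q0) := by
      simp only [sub_comp, mul_comp, X_comp, C_comp, e0, e1]; ring
    have hRm : (R * Q (N * (m+1))).Monic := hR.mul (hQm _)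
    have hRd : (R * Q (N * (m+1))).natDegree = N * (m+2) := by
      rw [hR.natDegree_mul (hQm _), hN, hQd]; ring
    have hlt : (C a * Q (N * m)).degree < (R * Q (N * (m+1))).degree := by
      apply degree_lt_degree
      rw [hRd]
      refine lt_of_le_of_lt (natDegree_C_mul_le _ _) ?_
      rw [hQd]
      exact Nat.mul_lt_mul_of_pos_left (by omega) hN0
    have hp0 : L (Q (N * m) ^ 2) ≠ 0 := (hpos _ (hQm _).ne_zero).ne'
    refine Q_unique L hpos (N * (m+2)) _ _ (hQm _) (hRm.sub_of_left hlt) (hQd _) ?_ (hQo _) ?_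
    · rw [natDegree_sub_eq_left_of_natDegree_lt, hRd]
      rw [hRd]
      refine lt_of_le_of_lt (natDegree_C_mul_le _ _) ?_
      rw [hQd]
      exact Nat.mul_lt_mul_of_pos_left (by omega) hN0
    · rw [← hgR]
      apply orth_aux L N R hR hN hA
      intro j hj
      have hexp : L ((X * q1 - C a * q0).comp R * R ^ j)
          = L (Q (N * (m+1)) * R ^ (j+1)) - a * L (Q (N * m) * R ^ j) := by
        rw [hgR, ← smul_eq_mul a, ← map_smul, ← map_sub, smul_eq_C_mul]
        congr 1; ring
      rcases Nat.lt_trichotomy j m with h | h | h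
      · rw [hexp, hlow _ _ h, hlow _ _ (by omega : j + 1 < m + 1)]; ring
      · rw [hexp, h, hlead, hlead, ha]; field_simp; ring
      · have hj' : j = m + 1 := by omega
        subst hj'
        have := hB ((X * q1 - C a * q0) * X ^ (m+1)) (by
          rw [mul_comp, hge, X_pow_comp, neg_pow (X : ℝ[X])]
          have : ((-1 : ℝ[X]) ^ m) * (-1) ^ m = 1 := by rw [← mul_pow]; simp
          linear_combination (-(X * q1 - C a * q0) * X ^ (m+1)) * this)
        rwa [mul_comp, X_pow_comp] at this
  have all : ∀ m, (∃ q : ℝ[X], Q (N * m) = q.comp R ∧ q.comp (-X) = (-1) ^ m * q) ∧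
      (∃ q : ℝ[X], Q (N * (m+1)) = q.comp R ∧ q.comp (-X) = (-1) ^ (m+1) * q) := by
    intro m
    induction m with
    | zero =>
      refine ⟨⟨1, ?_, by simp⟩, ⟨X, ?_, by simp⟩⟩
      · have := eq_one_of_monic_natDegree_zero (hQm 0) (hQd 0)
        simpa using this
      · simpa using hQN
    | succ m ih =>
      refine ⟨ih.2, ?_⟩
      obtain ⟨⟨q0, h0, e0⟩, ⟨q1, h1, e1⟩⟩ := ih
      refine ⟨X * q1 - C (L (Q (N * (m+1)) ^ 2) / L (Q (N * m) ^ 2)) * q0, ?_, ?_⟩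
      · rw [show m + 1 + 1 = m + 2 from rfl, step m q0 q1 h0 h1 e0 e1]
        simp only [sub_comp, mul_comp, X_comp, C_comp, ← h0, ← h1]
      · simp only [sub_comp, mul_comp, X_comp, C_comp, e0, e1]; ring
  intro m
  obtain ⟨⟨q0, h0, e0⟩, ⟨q1, h1, e1⟩⟩ := all m
  exact step m q0 q1 h0 h1 e0 e1

theorem stmt_14 (γ : ℕ → ℝ) (hγ : ∀ s : ℕ, 0 < γ (s + 1) ∧ γ (s + 1) < 1 / 4)
    (μ : Measure ℝ) [IsProbabilityMeasure μ]
    (hμint : ∀ p : Polynomial ℝ, Integrable (fun x => p.eval x) μ)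
    (hμpos : ∀ p : Polynomial ℝ, p ≠ 0 → 0 < ∫ x, (p.eval x) ^ 2 ∂μ)
    (hμconv : ∀ p : Polynomial ℝ,
      Tendsto (fun s => nuInt γ s (fun x => p.eval x)) atTop (nhds (∫ x, p.eval x ∂μ)))
    (Q : ℕ → Polynomial ℝ) (hQmonic : ∀ n, (Q n).Monic) (hQdeg : ∀ n, (Q n).natDegree = n)
    (hQorth : ∀ n : ℕ, ∀ p : Polynomial ℝ, p.degree < (n : WithBot ℕ) →
      ∫ x, (Q n).eval x * p.eval x ∂μ = 0)
    (s k : ℕ) (hk : 1 ≤ k) :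
    Q (2 ^ s * (2 * k + 1)) =
      Q (2 ^ s) * Q (2 ^ (s + 1) * k) -
        C ((∫ x, ((Q (2 ^ (s + 1) * k)).eval x) ^ 2 ∂μ) /
            (∫ x, ((Q (2 ^ s * (2 * k - 1))).eval x) ^ 2 ∂μ)) *
          Q (2 ^ s * (2 * k - 1)) := by
  let L : ℝ[X] →ₗ[ℝ] ℝ :=
    { toFun := fun p => ∫ x, p.eval x ∂μ
      map_add' := fun p q => by
        simp only [eval_add]; exact integral_add (hμint p) (hμint q)
      map_smul' := fun c p => by
        simp only [eval_smul, smul_eq_mul, RingHom.id_apply]; exact integral_const_mul c _ }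
  have hL : ∀ p : ℝ[X], L p = ∫ x, p.eval x ∂μ := fun p => rfl
  have hL2 : ∀ p : ℝ[X], L (p ^ 2) = ∫ x, (p.eval x) ^ 2 ∂μ := fun p => by
    rw [hL]; simp only [eval_pow]
  have hconv : ∀ p : ℝ[X], Tendsto (fun t => SS γ t 0 p / 2 ^ t) atTop (nhds (L p)) := by
    intro p
    have h := hμconv p
    have he : ∀ t, nuInt γ t (fun x => p.eval x) = SS γ t 0 p / 2 ^ t := by
      intro t; simp [nuInt, SS, RR]
    simp only [he] at h
    exact h
  have h0 : ∀ t, |(0:ℝ)| ≤ r γ t / 2 := fun t => by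
    rw [abs_zero]; have := r_pos γ hγ t; positivity
  have hB : ∀ f : ℝ[X], f.comp (-X) = -f → L (f.comp (RR γ s)) = 0 := by
    intro f hf
    refine tendsto_nhds_unique (hconv _) (tendsto_const_nhds.congr' ?_)
    filter_upwards [eventually_ge_atTop (s+1)] with t ht
    rw [SS_odd γ hγ s f hf t ht 0 (h0 t), zero_div]
  have hA : ∀ p f : ℝ[X], p.degree < ((2 ^ s : ℕ) : WithBot ℕ) →
      L (p * f.comp (RR γ s)) = L p * L (f.comp (RR γ s)) := by
    intro p f hp
    obtain ⟨c, hc⟩ := SS_prod γ hγ s p hp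
    have hLc : ∀ f : ℝ[X], L (p * f.comp (RR γ s)) = c * L (f.comp (RR γ s)) := by
      intro f
      refine tendsto_nhds_unique (hconv _) (((hconv (f.comp (RR γ s))).const_mul c).congr' ?_)
      filter_upwards [eventually_ge_atTop s] with t ht
      rw [hc f t ht 0 (h0 t), mul_div_assoc]
    have h1 := hLc 1
    have hone : L 1 = 1 := by rw [hL]; simp
    rw [one_comp, mul_one, hone, mul_one] at h1
    rw [hLc f, h1]
  obtain ⟨hm, hd⟩ := RR_monic γ s
  obtain ⟨e1, e2⟩ := rec_aux L (fun p hp => by rw [hL2]; exact hμpos p hp) (2 ^ s) (by positivity)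
    (RR γ s) hm hd hA hB Q hQmonic hQdeg (fun n p hp => by
      rw [hL]; simp only [eval_mul]; exact hQorth n p hp)
  have h := e2 (2 * k - 1)
  rw [← e1, hL2, hL2, show 2 * k - 1 + 2 = 2 * k + 1 by omega,
    show 2 * k - 1 + 1 = 2 * k by omega] at h
  rw [show 2 ^ (s + 1) * k = 2 ^ s * (2 * k) by ring]
  exact h
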